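/- arXiv:1708.04044 — 3 statements merged into one kernel-verified Lean document; each statement's English description precedes it below -/
import Mathlib

section
/- Let f ∈ C^p(ℝⁿ) with ‖∇ᵖf(x) − ∇ᵖf(y)‖ ≤ (p−1)!·L·‖x−y‖, and let m(x,s,σ) = T_p(x,s) + (σ/(p+1))‖s‖^{p+1}. Suppose s ≠ 0 satisfies ‖∇_s m(x,s,σ)‖ ≤ θ·‖s‖^p for some θ ≥ 0. Then ‖∇f(x+s)‖ ≤ (L + θ + σ)·‖s‖^p, and hence ‖s‖ ≥ (‖∇f(x+s)‖/(L + θ + σ))^{1/p}. -/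
open scoped BigOperators

/-- The degree-`p` Taylor polynomial of `f` at `x`, evaluated at increment `s`. -/
noncomputable def taylorP {n : ℕ} (p : ℕ) (f : EuclideanSpace ℝ (Fin n) → ℝ)
    (x s : EuclideanSpace ℝ (Fin n)) : ℝ :=
  ∑ j ∈ Finset.range (p + 1),
    (1 / (j.factorial : ℝ)) * iteratedFDeriv ℝ j f x (fun _ => s)

/-- The regularized Taylor model `m(x,s,σ) = T_p(x,s) + (σ/(p+1))‖s‖^{p+1}`. -/
noncomputable def modelM {n : ℕ} (p : ℕ) (f : EuclideanSpace ℝ (Fin n) → ℝ)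
    (x s : EuclideanSpace ℝ (Fin n)) (σ : ℝ) : ℝ :=
  taylorP p f x s + σ / ((p : ℝ) + 1) * ‖s‖ ^ (p + 1)

section IteratedFDeriv

variable {E : Type*} [NormedAddCommGroup E] [NormedSpace ℝ E] {g : E → ℝ}

/-- The directional derivative of a `C^(k+1)` function is `C^k`. -/
lemma ContDiff.fderiv_apply_const {k : ℕ} (hg : ContDiff ℝ (k + 1 : ℕ) g) (v : E) :
    ContDiff ℝ k (fun y => fderiv ℝ g y v) :=
  (hg.fderiv_right (m := k) (by norm_cast)).clm_apply contDiff_const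

lemma iteratedFDeriv_succ_apply_eq_fderiv_apply {k : ℕ} (hg : ContDiff ℝ (k + 1 : ℕ) g) (x : E)
    (m : Fin (k + 1) → E) :
    iteratedFDeriv ℝ (k + 1) g x m =
      iteratedFDeriv ℝ k (fun y => fderiv ℝ g y (m (Fin.last k))) x (Fin.init m) := by
  rw [iteratedFDeriv_succ_apply_right,
    iteratedFDeriv_clm_apply_const_apply (hg.fderiv_right (m := k) (by norm_cast)) le_rfl]

/-- Symmetry of the iterated derivative when all arguments but one coincide. -/
lemma iteratedFDeriv_succ_update_const {k : ℕ} (hg : ContDiff ℝ (k + 1 : ℕ) g) (x s v : E)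
    (i : Fin (k + 1)) :
    iteratedFDeriv ℝ (k + 1) g x (Function.update (fun _ => s) i v) =
      iteratedFDeriv ℝ k (fun y => fderiv ℝ g y v) x (fun _ => s) := by
  induction k generalizing g with
  | zero =>
    rw [iteratedFDeriv_succ_apply_eq_fderiv_apply hg, Fin.fin_one_eq_zero i, ← Fin.last_zero,
      Function.update_self]
    congr 1
    exact Subsingleton.elim _ _
  | succ k ih =>
    rw [iteratedFDeriv_succ_apply_eq_fderiv_apply hg]
    induction i using Fin.lastCases with
    | last =>
      rw [Function.update_self, Fin.init_update_last]
      rfl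
    | cast i =>
      rw [Function.update_of_ne (Fin.castSucc_lt_last i).ne', Fin.init_update_castSucc]
      refine (ih (hg.fderiv_apply_const s) i).trans ?_
      rw [iteratedFDeriv_succ_apply_eq_fderiv_apply (hg.fderiv_apply_const v)]
      have hd (y : E) : DifferentiableAt ℝ (fderiv ℝ g) y :=
        ((hg.fderiv_right (m := 1) (by norm_cast; omega)).differentiable one_ne_zero) y
      have hsymm : (fun y => fderiv ℝ (fun z => fderiv ℝ g z s) y v) =
          fun y => fderiv ℝ (fun z => fderiv ℝ g z v) y s := by
        funext y
        have h2 : IsSymmSndFDerivAt ℝ g y :=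
          hg.contDiffAt.isSymmSndFDerivAt (by simp; norm_cast; omega)
        rw [fderiv_clm_apply (hd y) (differentiableAt_const s),
          fderiv_clm_apply (hd y) (differentiableAt_const v)]
        simpa using h2.eq v s
      rw [hsymm]
      rfl

lemma iteratedDeriv_comp_add_smul {k : ℕ} (hg : ContDiff ℝ k g) (x s : E) :
    iteratedDeriv k (fun t : ℝ => g (x + t • s)) =
      fun t => iteratedFDeriv ℝ k g (x + t • s) (fun _ => s) := by
  induction k with
  | zero => ext t; simp
  | succ k ih =>
    rw [iteratedDeriv_succ, ih (hg.of_le (by norm_cast; omega))]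
    funext t
    exact ContDiffAt.deriv_fderiv_add_smul (by exact_mod_cast hg.contDiffAt)

end IteratedFDeriv

section Taylor

variable {n : ℕ} {f g : EuclideanSpace ℝ (Fin n) → ℝ}

/-- Taylor's theorem with Lagrange remainder along the segment from `x` to `x + s`. -/
lemma exists_sub_taylorP_eq {q : ℕ} (hg : ContDiff ℝ (q + 1 : ℕ) g)
    (x s : EuclideanSpace ℝ (Fin n)) :
    ∃ t ∈ Set.Ioo (0 : ℝ) 1, g (x + s) - taylorP (q + 1) g x s =
      (1 / ((q + 1).factorial : ℝ)) * (iteratedFDeriv ℝ (q + 1) g (x + t • s) (fun _ => s) -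
        iteratedFDeriv ℝ (q + 1) g x (fun _ => s)) := by
  have hline : ContDiff ℝ (q + 1 : ℕ) (fun t : ℝ => g (x + t • s)) :=
    hg.comp (contDiff_const.add (contDiff_id.smul contDiff_const))
  obtain ⟨t, ht, h⟩ := taylor_mean_remainder_lagrange_iteratedDeriv (n := q) (zero_ne_one' ℝ)
    (f := fun t : ℝ => g (x + t • s)) (by exact_mod_cast hline.contDiffOn)
  refine ⟨t, by simpa [Set.uIoo_of_lt] using ht, ?_⟩
  have hcoeff : taylorWithinEval (fun t : ℝ => g (x + t • s)) q (Set.uIcc 0 1) 0 1 =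
      taylorP q g x s := by
    rw [taylor_within_apply, taylorP]
    refine Finset.sum_congr rfl fun k hk => ?_
    have hk' : k ≤ q + 1 := by have := Finset.mem_range.mp hk; omega
    rw [iteratedDerivWithin_eq_iteratedDeriv (uniqueDiffOn_uIcc (zero_ne_one' ℝ))
      (hline.of_le (by exact_mod_cast hk')).contDiffAt (by simp),
      iteratedDeriv_comp_add_smul (hg.of_le (by exact_mod_cast hk'))]
    simp
  rw [hcoeff, iteratedDeriv_comp_add_smul hg] at h
  rw [taylorP, Finset.sum_range_succ, ← taylorP]
  simp only [one_smul, sub_zero, one_pow, mul_one] at h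
  linear_combination h

lemma hasFDerivAt_taylorP (p : ℕ) (x s : EuclideanSpace ℝ (Fin n)) :
    HasFDerivAt (taylorP p f x)
      (∑ j ∈ Finset.range (p + 1), (1 / (j.factorial : ℝ)) •
        ((iteratedFDeriv ℝ j f x).linearDeriv (fun _ => s)).comp
          (ContinuousLinearMap.pi fun _ => ContinuousLinearMap.id ℝ _)) s := by
  unfold taylorP
  refine HasFDerivAt.fun_sum fun j _ => HasFDerivAt.const_mul ?_ _
  exact ((iteratedFDeriv ℝ j f x).hasFDerivAt (fun _ => s)).comp s
    (hasFDerivAt_pi.2 fun _ => hasFDerivAt_id s)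

/-- Differentiating the Taylor polynomial gives the Taylor polynomial of the derivative. -/
lemma fderiv_taylorP_succ_apply {p : ℕ} (hf : ContDiff ℝ (p + 1 : ℕ) f)
    (x s v : EuclideanSpace ℝ (Fin n)) :
    fderiv ℝ (taylorP (p + 1) f x) s v = taylorP p (fun y => fderiv ℝ f y v) x s := by
  rw [(hasFDerivAt_taylorP (p + 1) x s).fderiv, taylorP, Finset.sum_range_succ']
  simp only [add_apply, sum_apply,
    smul_apply, ContinuousLinearMap.comp_apply,
    ContinuousMultilinearMap.linearDeriv_apply, ContinuousLinearMap.coe_pi',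
    ContinuousLinearMap.id_apply, Finset.univ_eq_empty, Finset.sum_empty, smul_zero, add_zero]
  refine Finset.sum_congr rfl fun k hk => ?_
  have hk' : k + 1 ≤ p + 1 := by have := Finset.mem_range.mp hk; omega
  simp only [iteratedFDeriv_succ_update_const (hf.of_le (by exact_mod_cast hk')),
    Finset.sum_const, Finset.card_univ, Fintype.card_fin, nsmul_eq_mul, smul_eq_mul]
  rw [Nat.factorial_succ]
  push_cast
  field_simp

/-- A Lipschitz `p`-th derivative controls the error of the gradient of the Taylor polynomial. -/
lemma norm_fderiv_sub_fderiv_taylorP_le {p : ℕ} (hp : 2 ≤ p) {L : ℝ} (hL : 0 ≤ L)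
    (hf : ContDiff ℝ p f)
    (hLip : ∀ x y : EuclideanSpace ℝ (Fin n),
      ‖iteratedFDeriv ℝ p f x - iteratedFDeriv ℝ p f y‖ ≤ ((p - 1).factorial : ℝ) * L * ‖x - y‖)
    (x s : EuclideanSpace ℝ (Fin n)) :
    ‖fderiv ℝ f (x + s) - fderiv ℝ (taylorP p f x) s‖ ≤ L * ‖s‖ ^ p := by
  obtain ⟨q, rfl⟩ : ∃ q, p = q + 2 := ⟨p - 2, by omega⟩
  refine ContinuousLinearMap.opNorm_le_bound _ (by positivity) fun v => ?_
  obtain ⟨t, ht, h⟩ := exists_sub_taylorP_eq (hf.fderiv_apply_const v) x s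
  rw [sub_apply, fderiv_taylorP_succ_apply hf, h]
  simp only [← iteratedFDeriv_succ_update_const hf _ s v (Fin.last _)]
  rw [← sub_apply, norm_mul]
  have hprod : ∏ i : Fin (q + 2), ‖Function.update (fun _ => s) (Fin.last (q + 1)) v i‖ =
      ‖s‖ ^ (q + 1) * ‖v‖ := by
    rw [Fin.prod_univ_castSucc]
    simp
  have hdist : ‖x + t • s - x‖ ≤ ‖s‖ := by
    rw [add_sub_cancel_left, norm_smul, Real.norm_of_nonneg ht.1.le]
    exact mul_le_of_le_one_left (norm_nonneg s) ht.2.le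
  calc ‖1 / ((q + 1).factorial : ℝ)‖ * _
      ≤ 1 / ((q + 1).factorial : ℝ) *
        (((q + 1).factorial : ℝ) * L * ‖s‖ * (‖s‖ ^ (q + 1) * ‖v‖)) := by
        rw [Real.norm_of_nonneg (by positivity)]
        gcongr
        refine (ContinuousMultilinearMap.le_opNorm _ _).trans ?_
        rw [hprod]
        gcongr
        exact (hLip _ _).trans (mul_le_mul_of_nonneg_left hdist (by positivity))
    _ = L * ‖s‖ ^ (q + 2) * ‖v‖ := by field_simp; ring

lemma norm_fderiv_modelM_sub_fderiv_taylorP {p : ℕ} (hp : 1 ≤ p) {σ : ℝ} (hσ : 0 ≤ σ)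
    (x s : EuclideanSpace ℝ (Fin n)) :
    ‖fderiv ℝ (fun s' => modelM p f x s' σ) s - fderiv ℝ (taylorP p f x) s‖ = σ * ‖s‖ ^ p := by
  have hp1 : (1 : ℝ) < ((p + 1 : ℕ) : ℝ) := by exact_mod_cast (by omega : 1 < p + 1)
  have hnorm := hasFDerivAt_norm_rpow s hp1
  simp only [Real.rpow_natCast] at hnorm
  have hT := hasFDerivAt_taylorP (f := f) p x s
  have hM := hT.add (hnorm.const_mul (σ / ((p : ℝ) + 1)))
  have hM' : fderiv ℝ (fun s' => modelM p f x s' σ) s = _ := hM.fderiv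
  have hpow : ‖s‖ ^ (((p + 1 : ℕ) : ℝ) - 2) = ‖s‖ ^ (p - 1) := by
    rw [← Real.rpow_natCast]
    congr 1
    push_cast [hp]
    ring
  rw [hM', hT.fderiv, add_sub_cancel_left, norm_smul, norm_smul, innerSL_apply_norm, hpow,
    Real.norm_of_nonneg (by positivity), Real.norm_of_nonneg (by positivity), mul_assoc,
    ← pow_succ, Nat.sub_add_cancel hp]
  push_cast
  field_simp

end Taylor

theorem stmt8 {n : ℕ} (p : ℕ) (hp : 2 ≤ p) (f : EuclideanSpace ℝ (Fin n) → ℝ)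
    (L θ σ : ℝ) (hL : 0 ≤ L) (hθ : 0 ≤ θ) (hσ : 0 < σ)
    (hf : ContDiff ℝ (p : ℕ∞) f)
    (hLip : ∀ x y : EuclideanSpace ℝ (Fin n),
      ‖iteratedFDeriv ℝ p f x - iteratedFDeriv ℝ p f y‖ ≤ ((p - 1).factorial : ℝ) * L * ‖x - y‖)
    (x s : EuclideanSpace ℝ (Fin n)) (hs : s ≠ 0)
    (hgrad : ‖gradient (fun s' => modelM p f x s' σ) s‖ ≤ θ * ‖s‖ ^ p) :
    ‖gradient f (x + s)‖ ≤ (L + θ + σ) * ‖s‖ ^ p ∧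
      ‖s‖ ≥ (‖gradient f (x + s)‖ / (L + θ + σ)) ^ ((1 : ℝ) / p) := by
  have hnorm (h : EuclideanSpace ℝ (Fin n) → ℝ) (y : EuclideanSpace ℝ (Fin n)) :
      ‖gradient h y‖ = ‖fderiv ℝ h y‖ := by
    simp [gradient]
  rw [hnorm] at hgrad
  rw [hnorm]
  have hbound : ‖fderiv ℝ f (x + s)‖ ≤ (L + θ + σ) * ‖s‖ ^ p := by
    have h1 := norm_fderiv_sub_fderiv_taylorP_le hp hL (by exact_mod_cast hf) hLip x s
    have h2 := norm_fderiv_modelM_sub_fderiv_taylorP (f := f) (by omega : 1 ≤ p) hσ.le x s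
    have h3 := norm_sub_norm_le (fderiv ℝ f (x + s)) (fderiv ℝ (taylorP p f x) s)
    have h4 := norm_sub_norm_le (fderiv ℝ (taylorP p f x) s)
      (fderiv ℝ (fun s' => modelM p f x s' σ) s)
    rw [norm_sub_rev (fderiv ℝ (taylorP p f x) s)] at h4
    linarith
  refine ⟨hbound, ?_⟩
  have hpos : 0 < L + θ + σ := by positivity
  calc (‖fderiv ℝ f (x + s)‖ / (L + θ + σ)) ^ ((1 : ℝ) / p)
      ≤ (‖s‖ ^ p) ^ ((1 : ℝ) / p) := by
        gcongr
        rwa [div_le_iff₀' hpos]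
    _ = ‖s‖ := by rw [one_div, Real.pow_rpow_inv_natCast (norm_nonneg s) (by omega)]
end

section
/- Let f ∈ C^p(ℝⁿ) (p ≥ 2) with ‖∇ᵖf(x) − ∇ᵖf(y)‖ ≤ (p−1)!·L·‖x−y‖, and let m(x,s,σ) = T_p(x,s) + (σ/(p+1))‖s‖^{p+1}. Suppose s ≠ 0 satisfies max(0, −λ_min(∇²_s m(x,s,σ))) ≤ θ·‖s‖^{p−1}. Then max(0, −λ_min(∇²f(x+s))) ≤ ((p−1)L + θ + pσ)·‖s‖^{p−1}, and hence ‖s‖ ≥ (max(0, −λ_min(∇²f(x+s)))/((p−1)L + θ + pσ))^{1/(p−1)}. -/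
open scoped BigOperators

/-- The leftmost eigenvalue of the Hessian of `g` at `z`, via the Rayleigh quotient. -/
noncomputable def lambdaMin {n : ℕ} (g : EuclideanSpace ℝ (Fin n) → ℝ)
    (z : EuclideanSpace ℝ (Fin n)) : ℝ :=
  sInf {r : ℝ | ∃ y : EuclideanSpace ℝ (Fin n), ‖y‖ = 1 ∧ iteratedFDeriv ℝ 2 g z ![y, y] = r}

section TaylorExpansion

universe u

variable {E F : Type u} [NormedAddCommGroup E] [NormedSpace ℝ E]
  [NormedAddCommGroup F] [NormedSpace ℝ F]

/-- The degree-`q` Taylor polynomial at `x` of a function with values in a normed space. -/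
noncomputable def taylorPoly (q : ℕ) (g : E → F) (x s : E) : F :=
  ∑ j ∈ Finset.range (q + 1), (1 / (j.factorial : ℝ)) • iteratedFDeriv ℝ j g x (fun _ => s)

lemma iteratedFDeriv_succ_diag (j : ℕ) (g : E → F) (x s : E) :
    iteratedFDeriv ℝ (j + 1) g x (fun _ => s) =
      iteratedFDeriv ℝ j (fderiv ℝ g) x (fun _ => s) s := by
  rw [iteratedFDeriv_succ_apply_right]
  rfl

lemma ContDiff.iteratedFDeriv_fderiv_fderiv_comm {j : ℕ} {g : E → F}
    (hg : ContDiff ℝ ((j + 2 : ℕ) : ℕ∞) g) (x : E) (m : Fin j → E) (v w : E) :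
    iteratedFDeriv ℝ j (fderiv ℝ (fderiv ℝ g)) x m v w =
      iteratedFDeriv ℝ j (fderiv ℝ (fderiv ℝ g)) x m w v := by
  have hflip : fderiv ℝ (fderiv ℝ g) =
      (ContinuousLinearMap.flipₗᵢ ℝ E E F).toContinuousLinearEquiv ∘ fderiv ℝ (fderiv ℝ g) := by
    ext z a b
    have hsymm : IsSymmSndFDerivAt ℝ g z :=
      hg.contDiffAt.isSymmSndFDerivAt (by simp)
    exact hsymm a b
  conv_lhs => rw [hflip]
  have hcomp := ContinuousLinearEquiv.iteratedFDeriv_comp_left (𝕜 := ℝ) (G := E →L[ℝ] E →L[ℝ] F)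
    (f := fderiv ℝ (fderiv ℝ g)) (x := x) (i := j)
    (ContinuousLinearMap.flipₗᵢ ℝ E E F).toContinuousLinearEquiv
  exact congrArg (fun A => A m v w) hcomp

lemma ContDiff.hasFDerivAt_iteratedFDeriv_diag {j : ℕ} {g : E → F}
    (hg : ContDiff ℝ ((j + 1 : ℕ) : ℕ∞) g) (x s : E) :
    HasFDerivAt (fun z => iteratedFDeriv ℝ (j + 1) g x (fun _ => z))
      (((j : ℝ) + 1) • iteratedFDeriv ℝ j (fderiv ℝ g) x (fun _ => s)) s := by
  induction j generalizing F with
  | zero =>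
    simpa [iteratedFDeriv_succ_diag] using (fderiv ℝ g x).hasFDerivAt (x := s)
  | succ j ih =>
    have hg' : ContDiff ℝ ((j + 1 : ℕ) : ℕ∞) (fderiv ℝ g) :=
      hg.fderiv_right (by norm_cast)
    have h := (ih hg').clm_apply (hasFDerivAt_id s)
    simp_rw [iteratedFDeriv_succ_diag (j + 1) g]
    refine h.congr_fderiv ?_
    ext v
    simp [iteratedFDeriv_succ_diag, hg.iteratedFDeriv_fderiv_fderiv_comm x _ v s]
    module

lemma ContDiff.hasFDerivAt_taylorPoly {q : ℕ} {g : E → F}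
    (hg : ContDiff ℝ ((q + 1 : ℕ) : ℕ∞) g) (x s : E) :
    HasFDerivAt (taylorPoly (q + 1) g x) (taylorPoly q (fderiv ℝ g) x s) s := by
  unfold taylorPoly
  simp_rw [Finset.sum_range_succ' _ (q + 1)]
  simp only [iteratedFDeriv_zero_apply]
  refine HasFDerivAt.add_const _ (HasFDerivAt.fun_sum fun j hj => ?_)
  have hj' : j ≤ q := Nat.lt_succ_iff.mp (Finset.mem_range.mp hj)
  have hgj : ContDiff ℝ ((j + 1 : ℕ) : ℕ∞) g := hg.of_le (by norm_cast; omega)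
  refine ((hgj.hasFDerivAt_iteratedFDeriv_diag x s).const_smul _).congr_fderiv ?_
  rw [smul_smul]
  congr 1
  rw [Nat.factorial_succ]
  push_cast
  have : (j.factorial : ℝ) ≠ 0 := by positivity
  field_simp

lemma taylorPoly_zero_right (q : ℕ) (g : E → F) (x : E) : taylorPoly q g x 0 = g x := by
  unfold taylorPoly
  rw [Finset.sum_range_succ', Finset.sum_eq_zero]
  · simp
  · intro j _
    rw [(iteratedFDeriv ℝ (j + 1) g x).map_coord_zero 0 rfl, smul_zero]

lemma norm_iteratedFDeriv_succ_sub (j : ℕ) (g : E → F) (x y : E) :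
    ‖iteratedFDeriv ℝ (j + 1) g x - iteratedFDeriv ℝ (j + 1) g y‖ =
      ‖iteratedFDeriv ℝ j (fderiv ℝ g) x - iteratedFDeriv ℝ j (fderiv ℝ g) y‖ := by
  simp only [iteratedFDeriv_succ_eq_comp_right, Function.comp_apply]
  simpa only [dist_eq_norm] using
    (continuousMultilinearCurryRightEquiv' ℝ j E F).symm.dist_map
      (iteratedFDeriv ℝ j (fderiv ℝ g) x) (iteratedFDeriv ℝ j (fderiv ℝ g) y)

/-- Taylor remainder bound for a function whose `q`-th derivative is Lipschitz. -/
lemma ContDiff.norm_sub_taylorPoly_le {q : ℕ} {g : E → F} {C : ℝ}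
    (hg : ContDiff ℝ (q : ℕ∞) g)
    (hLip : ∀ x y, ‖iteratedFDeriv ℝ q g x - iteratedFDeriv ℝ q g y‖ ≤ C * ‖x - y‖) (x s : E) :
    ‖g (x + s) - taylorPoly q g x s‖ ≤ C * ‖s‖ ^ (q + 1) / (q + 1).factorial := by
  induction q generalizing F s with
  | zero =>
    have h := hLip (x + s) x
    rw [iteratedFDeriv_zero_eq_comp, Function.comp_apply, Function.comp_apply, ← map_sub,
      LinearIsometryEquiv.norm_map] at h
    simpa [taylorPoly] using h
  | succ q ih =>
    have hg' : ContDiff ℝ (q : ℕ∞) (fderiv ℝ g) := hg.fderiv_right (by norm_cast)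
    have hLip' : ∀ x y, ‖iteratedFDeriv ℝ q (fderiv ℝ g) x - iteratedFDeriv ℝ q (fderiv ℝ g) y‖
        ≤ C * ‖x - y‖ := by
      simpa only [norm_iteratedFDeriv_succ_sub] using hLip
    have hdiff : Differentiable ℝ g := hg.differentiable (by simp)
    have hrem : ∀ z, HasFDerivAt (fun z => g (x + z) - taylorPoly (q + 1) g x z)
        (fderiv ℝ g (x + z) - taylorPoly q (fderiv ℝ g) x z) z := fun z =>
      ((hdiff (x + z)).hasFDerivAt.comp z ((hasFDerivAt_id z).const_add x)).sub
        (hg.hasFDerivAt_taylorPoly x z)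
    have hline : ∀ t : ℝ, HasDerivAt (fun t : ℝ => g (x + t • s) - taylorPoly (q + 1) g x (t • s))
        ((fderiv ℝ g (x + t • s) - taylorPoly q (fderiv ℝ g) x (t • s)) s) t := by
      intro t
      have hts : HasDerivAt (fun t : ℝ => t • s) s t := by
        simpa using (hasDerivAt_id t).smul_const s
      exact (hrem (t • s)).comp_hasDerivAt t hts
    have hB : ∀ t : ℝ, HasDerivAt
        (fun t : ℝ => C * ‖s‖ ^ (q + 2) / (q + 2).factorial * t ^ (q + 2))
        (C * ‖s‖ ^ (q + 2) / (q + 1).factorial * t ^ (q + 1)) t := by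
      intro t
      refine ((hasDerivAt_pow (q + 2) t).const_mul _).congr_deriv ?_
      rw [Nat.factorial_succ (q + 1)]
      push_cast
      have : ((q + 1).factorial : ℝ) ≠ 0 := by positivity
      field_simp
      ring
    have h := image_norm_le_of_norm_deriv_right_le_deriv_boundary (a := 0) (b := 1)
      (fun t _ => (hline t).continuousAt.continuousWithinAt)
      (fun t _ => (hline t).hasDerivWithinAt) (by simp [taylorPoly_zero_right]) hB
      (fun t ht => ?_) (Set.right_mem_Icc.mpr zero_le_one)
    · simpa using h
    · refine (ContinuousLinearMap.le_opNorm _ _).trans ?_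
      refine (mul_le_mul_of_nonneg_right (ih hg' hLip' (t • s)) (norm_nonneg s)).trans_eq ?_
      rw [norm_smul, Real.norm_of_nonneg ht.1]
      ring

end TaylorExpansion

section NormPow

open scoped RealInnerProductSpace

variable {E : Type*} [NormedAddCommGroup E] [InnerProductSpace ℝ E]

lemma hasFDerivAt_norm_pow_add_three (k : ℕ) (z : E) :
    HasFDerivAt (fun z : E => ‖z‖ ^ (k + 3)) ((((k : ℝ) + 3) * ‖z‖ ^ (k + 1)) • innerSL ℝ z) z := by
  have h := hasFDerivAt_norm_rpow z (p := ((k + 3 : ℕ) : ℝ)) (by push_cast; linarith)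
  have he : ((k + 3 : ℕ) : ℝ) - 2 = ((k + 1 : ℕ) : ℝ) := by push_cast; ring
  rw [he] at h
  simp only [Real.rpow_natCast] at h
  simpa using h

lemma differentiableAt_fderiv_norm_pow {s : E} (hs : s ≠ 0) (k : ℕ) :
    DifferentiableAt ℝ (fderiv ℝ fun z : E => ‖z‖ ^ k) s :=
  (((contDiffAt_norm ℝ hs).pow k).fderiv_right (m := 1) (n := 2) (by norm_num)).differentiableAt
    (by simp)

lemma hasFDerivAt_norm_of_ne_zero {s : E} (hs : s ≠ 0) :
    HasFDerivAt (fun z : E => ‖z‖) (‖s‖⁻¹ • innerSL ℝ s) s := by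
  have h := (hasStrictFDerivAt_norm_sq s).hasFDerivAt.sqrt (by simpa using hs)
  simp only [Real.sqrt_sq (norm_nonneg _)] at h
  refine h.congr_fderiv ?_
  ext v
  simp
  ring

lemma fderiv_fderiv_norm_pow_apply_self_le {s : E} (hs : s ≠ 0) (k : ℕ) (y : E) :
    fderiv ℝ (fderiv ℝ fun z : E => ‖z‖ ^ (k + 3)) s y y ≤
      ((k : ℝ) + 3) * (k + 2) * ‖s‖ ^ (k + 1) * ‖y‖ ^ 2 := by
  have hs' : 0 < ‖s‖ := norm_pos_iff.mpr hs
  have hgrad : (fun z : E => fderiv ℝ (fun z : E => ‖z‖ ^ (k + 3)) z y) =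
      fun z => ((k : ℝ) + 3) * ‖z‖ ^ (k + 1) * ⟪z, y⟫ := by
    ext z
    rw [(hasFDerivAt_norm_pow_add_three k z).fderiv]
    simp
  have happly := (differentiableAt_fderiv_norm_pow hs (k + 3)).hasFDerivAt.clm_apply
    (hasFDerivAt_const y s)
  rw [hgrad] at happly
  have hdirect := ((((hasFDerivAt_norm_of_ne_zero hs).pow (k + 1)).const_mul ((k : ℝ) + 3)).mul
    ((hasFDerivAt_id s).inner ℝ (hasFDerivAt_const y s)))
  have heq := congrArg (fun A : E →L[ℝ] ℝ => A y) (happly.unique hdirect)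
  have hval : fderiv ℝ (fderiv ℝ fun z : E => ‖z‖ ^ (k + 3)) s y y =
      ((k : ℝ) + 3) * (‖s‖ ^ (k + 1) * ‖y‖ ^ 2 + (k + 1) * ‖s‖ ^ k * ‖s‖⁻¹ * ⟪s, y⟫ ^ 2) := by
    simp at heq
    rw [heq]
    ring
  have hcs : ⟪s, y⟫ ^ 2 ≤ ‖s‖ ^ 2 * ‖y‖ ^ 2 := by
    rw [← mul_pow, ← sq_abs]
    exact pow_le_pow_left₀ (abs_nonneg _) (abs_real_inner_le_norm s y) 2
  have hle : (k + 1) * ‖s‖ ^ k * ‖s‖⁻¹ * ⟪s, y⟫ ^ 2 ≤ ((k : ℝ) + 1) * ‖s‖ ^ (k + 1) * ‖y‖ ^ 2 := by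
    calc (k + 1) * ‖s‖ ^ k * ‖s‖⁻¹ * ⟪s, y⟫ ^ 2
        ≤ (k + 1) * ‖s‖ ^ k * ‖s‖⁻¹ * (‖s‖ ^ 2 * ‖y‖ ^ 2) := by gcongr
      _ = ((k : ℝ) + 1) * ‖s‖ ^ (k + 1) * ‖y‖ ^ 2 := by
        field_simp
        ring
  rw [hval]
  calc ((k : ℝ) + 3) * (‖s‖ ^ (k + 1) * ‖y‖ ^ 2 + (k + 1) * ‖s‖ ^ k * ‖s‖⁻¹ * ⟪s, y⟫ ^ 2)
      ≤ ((k : ℝ) + 3) * (‖s‖ ^ (k + 1) * ‖y‖ ^ 2 + (k + 1) * ‖s‖ ^ (k + 1) * ‖y‖ ^ 2) := by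
        gcongr
    _ = ((k : ℝ) + 3) * (k + 2) * ‖s‖ ^ (k + 1) * ‖y‖ ^ 2 := by ring

end NormPow

section LeftmostEigenvalue

variable {n : ℕ}

lemma lambdaMin_le (g : EuclideanSpace ℝ (Fin n) → ℝ) (z : EuclideanSpace ℝ (Fin n))
    {y : EuclideanSpace ℝ (Fin n)} (hy : ‖y‖ = 1) :
    lambdaMin g z ≤ iteratedFDeriv ℝ 2 g z ![y, y] := by
  refine csInf_le ⟨-‖iteratedFDeriv ℝ 2 g z‖, ?_⟩ ⟨y, hy, rfl⟩
  rintro _ ⟨w, hw, rfl⟩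
  have h := (iteratedFDeriv ℝ 2 g z).le_opNorm ![w, w]
  simp only [Fin.prod_univ_two, Matrix.cons_val_zero, Matrix.cons_val_one, hw, mul_one] at h
  exact (abs_le.mp h).1

lemma le_lambdaMin [Nontrivial (EuclideanSpace ℝ (Fin n))] {g : EuclideanSpace ℝ (Fin n) → ℝ}
    {z : EuclideanSpace ℝ (Fin n)} {c : ℝ}
    (h : ∀ y : EuclideanSpace ℝ (Fin n), ‖y‖ = 1 → c ≤ iteratedFDeriv ℝ 2 g z ![y, y]) :
    c ≤ lambdaMin g z := by
  obtain ⟨y, hy⟩ := exists_norm_eq (EuclideanSpace ℝ (Fin n)) zero_le_one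
  refine le_csInf ⟨_, y, hy, rfl⟩ ?_
  rintro _ ⟨w, hw, rfl⟩
  exact h w hw

lemma fderiv_fderiv_modelM {k : ℕ} {f : EuclideanSpace ℝ (Fin n) → ℝ}
    (hf : ContDiff ℝ ((k + 2 : ℕ) : ℕ∞) f) (x : EuclideanSpace ℝ (Fin n)) (σ : ℝ)
    {s : EuclideanSpace ℝ (Fin n)} (hs : s ≠ 0) :
    fderiv ℝ (fderiv ℝ fun z => modelM (k + 2) f x z σ) s =
      taylorPoly k (fderiv ℝ (fderiv ℝ f)) x s +
        (σ / ((k : ℝ) + 3)) • fderiv ℝ (fderiv ℝ fun z => ‖z‖ ^ (k + 3)) s := by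
  have hm : (fun z => modelM (k + 2) f x z σ) =
      fun z => taylorPoly (k + 2) f x z + (σ / ((k : ℝ) + 3)) • ‖z‖ ^ (k + 3) := by
    ext z
    simp only [modelM, taylorP, taylorPoly, smul_eq_mul]
    push_cast
    ring_nf
  have hgrad : (fderiv ℝ fun z => modelM (k + 2) f x z σ) = fun z =>
      taylorPoly (k + 1) (fderiv ℝ f) x z +
        (σ / ((k : ℝ) + 3)) • fderiv ℝ (fun z => ‖z‖ ^ (k + 3)) z := by
    ext1 z
    rw [hm]
    exact ((hf.hasFDerivAt_taylorPoly x z).add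
      ((hasFDerivAt_norm_pow_add_three k z).differentiableAt.hasFDerivAt.const_smul
        (σ / ((k : ℝ) + 3)))).fderiv
  have hf' : ContDiff ℝ ((k + 1 : ℕ) : ℕ∞) (fderiv ℝ f) := hf.fderiv_right (by norm_cast)
  rw [hgrad]
  exact ((hf'.hasFDerivAt_taylorPoly x s).add
    ((differentiableAt_fderiv_norm_pow hs (k + 3)).hasFDerivAt.const_smul
        (σ / ((k : ℝ) + 3)))).fderiv

lemma lambdaMin_modelM_le {k : ℕ} {f : EuclideanSpace ℝ (Fin n) → ℝ} {L σ : ℝ} (hσ : 0 ≤ σ)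
    (hf : ContDiff ℝ ((k + 2 : ℕ) : ℕ∞) f)
    (hLip : ∀ x y : EuclideanSpace ℝ (Fin n),
      ‖iteratedFDeriv ℝ (k + 2) f x - iteratedFDeriv ℝ (k + 2) f y‖ ≤
        ((k + 1).factorial : ℝ) * L * ‖x - y‖)
    (x : EuclideanSpace ℝ (Fin n)) {s : EuclideanSpace ℝ (Fin n)} (hs : s ≠ 0) :
    lambdaMin (fun z => modelM (k + 2) f x z σ) s - (L + ((k : ℝ) + 2) * σ) * ‖s‖ ^ (k + 1) ≤
      lambdaMin f (x + s) := by
  have : Nontrivial (EuclideanSpace ℝ (Fin n)) := ⟨s, 0, hs⟩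
  have hf' : ContDiff ℝ (k : ℕ∞) (fderiv ℝ (fderiv ℝ f)) :=
    ContDiff.fderiv_right (m := (k : ℕ∞)) (n := ((k + 1 : ℕ) : ℕ∞))
      (hf.fderiv_right (by norm_cast)) (by norm_cast)
  have hLip' : ∀ x y, ‖iteratedFDeriv ℝ k (fderiv ℝ (fderiv ℝ f)) x -
      iteratedFDeriv ℝ k (fderiv ℝ (fderiv ℝ f)) y‖ ≤
        ((k + 1).factorial : ℝ) * L * ‖x - y‖ := by
    simpa only [norm_iteratedFDeriv_succ_sub] using hLip
  have hrem : ‖fderiv ℝ (fderiv ℝ f) (x + s) - taylorPoly k (fderiv ℝ (fderiv ℝ f)) x s‖ ≤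
      L * ‖s‖ ^ (k + 1) := by
    refine (hf'.norm_sub_taylorPoly_le hLip' x s).trans_eq ?_
    have : ((k + 1).factorial : ℝ) ≠ 0 := by positivity
    field_simp
  refine le_lambdaMin fun y hy => ?_
  have hmodel := lambdaMin_le (fun z => modelM (k + 2) f x z σ) s hy
  rw [iteratedFDeriv_two_apply, fderiv_fderiv_modelM hf x σ hs] at hmodel
  rw [iteratedFDeriv_two_apply]
  simp only [Matrix.cons_val_zero, Matrix.cons_val_one, _root_.add_apply,
    _root_.smul_apply, smul_eq_mul] at hmodel ⊢
  have hpow : σ / ((k : ℝ) + 3) * fderiv ℝ (fderiv ℝ fun z => ‖z‖ ^ (k + 3)) s y y ≤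
      ((k : ℝ) + 2) * σ * ‖s‖ ^ (k + 1) := by
    have h := fderiv_fderiv_norm_pow_apply_self_le hs k y
    refine (mul_le_mul_of_nonneg_left h (by positivity)).trans_eq ?_
    rw [hy]
    field_simp
  have hbilin : |(fderiv ℝ (fderiv ℝ f) (x + s) -
      taylorPoly k (fderiv ℝ (fderiv ℝ f)) x s) y y| ≤ L * ‖s‖ ^ (k + 1) := by
    have h := ContinuousLinearMap.le_opNorm₂ (fderiv ℝ (fderiv ℝ f) (x + s) -
      taylorPoly k (fderiv ℝ (fderiv ℝ f)) x s) y y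
    rw [hy, mul_one, mul_one] at h
    exact h.trans hrem
  have hlow := (abs_le.mp hbilin).1
  simp only [_root_.sub_apply] at hlow
  linarith

end LeftmostEigenvalue

theorem stmt9 {n : ℕ} (p : ℕ) (hp : 2 ≤ p) (f : EuclideanSpace ℝ (Fin n) → ℝ)
    (L θ σ : ℝ) (hL : 0 ≤ L) (hθ : 0 ≤ θ) (hσ : 0 < σ)
    (hf : ContDiff ℝ (p : ℕ∞) f)
    (hLip : ∀ x y : EuclideanSpace ℝ (Fin n),
      ‖iteratedFDeriv ℝ p f x - iteratedFDeriv ℝ p f y‖ ≤ ((p - 1).factorial : ℝ) * L * ‖x - y‖)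
    (x s : EuclideanSpace ℝ (Fin n)) (hs : s ≠ 0)
    (hmodel : max 0 (-(lambdaMin (fun s' => modelM p f x s' σ) s)) ≤ θ * ‖s‖ ^ (p - 1)) :
    max 0 (-(lambdaMin f (x + s))) ≤ (((p : ℝ) - 1) * L + θ + p * σ) * ‖s‖ ^ (p - 1) ∧
      ‖s‖ ≥ (max 0 (-(lambdaMin f (x + s))) / (((p : ℝ) - 1) * L + θ + p * σ)) ^
        ((1 : ℝ) / ((p : ℝ) - 1)) := by
  obtain ⟨k, rfl⟩ : ∃ k, p = k + 2 := ⟨p - 2, by omega⟩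
  have hk : k + 2 - 1 = k + 1 := by omega
  rw [hk] at hLip hmodel ⊢
  have hs' : 0 < ‖s‖ := norm_pos_iff.mpr hs
  have hpow : 0 < ‖s‖ ^ (k + 1) := by positivity
  push_cast
  have hp1 : (k : ℝ) + 2 - 1 = k + 1 := by ring
  rw [hp1]
  set K : ℝ := ((k : ℝ) + 1) * L + θ + (k + 2) * σ with hK
  have hKpos : 0 < K := by positivity
  have hfirst : max 0 (-(lambdaMin f (x + s))) ≤ K * ‖s‖ ^ (k + 1) := by
    have h := lambdaMin_modelM_le hσ.le hf hLip x hs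
    have hθ' := (le_max_right _ _).trans hmodel
    have hL' : 0 ≤ (k : ℝ) * L * ‖s‖ ^ (k + 1) := by positivity
    refine max_le (by positivity) ?_
    rw [hK]
    linarith
  refine ⟨hfirst, ?_⟩
  have hdiv : max 0 (-(lambdaMin f (x + s))) / K ≤ ‖s‖ ^ (k + 1) := by
    rwa [div_le_iff₀' hKpos]
  calc (max 0 (-(lambdaMin f (x + s))) / K) ^ ((1 : ℝ) / ((k : ℝ) + 1))
      ≤ (‖s‖ ^ (k + 1)) ^ ((1 : ℝ) / ((k : ℝ) + 1)) := by gcongr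
    _ = ‖s‖ := by
      have h := Real.pow_rpow_inv_natCast hs'.le (Nat.succ_ne_zero k)
      simpa using h
end

section
/- Let f ∈ C^p(ℝⁿ) (p ≥ 2) be bounded below by f_low with ‖∇ᵖf(x) − ∇ᵖf(y)‖ ≤ (p−1)!·L·‖x−y‖. Consider any iteration of the ARp algorithm with regularization parameters satisfying σ_min ≤ σ_k ≤ σ_max, at which the step s_k satisfies the model decrease T_p(x_k,0) − T_p(x_k,s_k) ≥ (σ_k/(p+1))‖s_k‖^{p+1}, the approximate model optimality ‖∇_s m(x_k,s_k,σ_k)‖ ≤ θ‖s_k‖^p, and the acceptance test f(x_k) − f(x_k+s_k) ≥ η₁·(T_p(x_k,0) − T_p(x_k,s_k)) with η₁ ∈ (0,1). If ‖∇f(x_k + s_k)‖ > ε₁, then f(x_k) − f(x_k+s_k) ≥ (η₁σ_min/(p+1))·(ε₁/(L+θ+σ_max))^{(p+1)/p}. -/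
open scoped BigOperators

section Taylor

variable {E : Type*} [NormedAddCommGroup E] [NormedSpace ℝ E]

/-- On arguments that are all equal to `s` except one, which equals `v`, the iterated derivative
does not depend on the position of `v`. -/
theorem iteratedFDeriv_update_const_eq_last (j : ℕ) {f : E → ℝ}
    (hf : ContDiff ℝ ((j + 1 : ℕ) : WithTop ℕ∞) f) (x s v : E) (i : Fin (j + 1)) :
    iteratedFDeriv ℝ (j + 1) f x (Function.update (fun _ => s) i v) =
      iteratedFDeriv ℝ (j + 1) f x (Function.update (fun _ => s) (Fin.last j) v) := by
  induction j generalizing x with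
  | zero => rw [show i = Fin.last 0 from Fin.ext (by simp)]
  | succ j ih =>
    have hd : Differentiable ℝ (iteratedFDeriv ℝ (j + 1) f) :=
      hf.differentiable_iteratedFDeriv (by exact_mod_cast Nat.lt_succ_self _)
    have hd' : Differentiable ℝ (iteratedFDeriv ℝ j f) :=
      hf.differentiable_iteratedFDeriv (by exact_mod_cast (by omega : j < j + 1 + 1))
    have hsucc (i : Fin (j + 1)) (x : E) :
        iteratedFDeriv ℝ (j + 1 + 1) f x (Function.update (fun _ => s) i.succ v) =
          iteratedFDeriv ℝ (j + 1 + 1) f x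
            (Function.update (fun _ => s) (Fin.last (j + 1)) v) := by
      rw [← Fin.succ_last, (hd x).iteratedFDeriv_succ_apply_left',
        (hd x).iteratedFDeriv_succ_apply_left']
      simp only [Fin.tail_update_succ]
      have : (Fin.tail fun _ : Fin (j + 1 + 1) => s) = fun _ => s := rfl
      simp only [this]
      congr 2
      funext y
      exact ih (hf.of_le (by exact_mod_cast Nat.le_succ _)) y i
    induction i using Fin.cases with
    | succ i => exact hsucc i x
    | zero =>
      rw [← hsucc 0 x]
      set g : E → ℝ := fun y => iteratedFDeriv ℝ j f y (fun _ => s) with hg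
      have hgc : ContDiff ℝ 2 g := by
        have h : ContDiff ℝ 2 (iteratedFDeriv ℝ j f) :=
          hf.iteratedFDeriv_right (by norm_cast; omega)
        exact (ContinuousMultilinearMap.apply ℝ (fun _ : Fin j => E) ℝ (fun _ => s)).contDiff.comp h
      have key (a b : E) (m : Fin (j + 1 + 1) → E) (h0 : m 0 = a) (h1 : m 1 = b)
          (h2 : Fin.tail (Fin.tail m) = fun _ => s) :
          iteratedFDeriv ℝ (j + 1 + 1) f x m = fderiv ℝ (fderiv ℝ g) x a b := by
        rw [(hd x).iteratedFDeriv_succ_apply_left']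
        have : (fun y => iteratedFDeriv ℝ (j + 1) f y (Fin.tail m)) =
            fun y => fderiv ℝ g y b := by
          funext y
          rw [(hd' y).iteratedFDeriv_succ_apply_left', h2]
          simp [Fin.tail, h1, hg]
        rw [this, h0, fderiv_clm_apply
          ((hgc.fderiv_right (m := 1) (by norm_num)).differentiable one_ne_zero x)
          (differentiableAt_const b)]
        simp
      rw [key v s _ (by simp) (by simp) (by ext; simp [Fin.tail]),
        key s v _ (by simp [Function.update]) (by simp)
          (by funext k; simp [Fin.tail, Function.update, Fin.ext_iff])]
      exact (hgc.contDiffAt.isSymmSndFDerivAt (by simp)) v s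

theorem iteratedDeriv_fderiv_comp_line {p : ℕ} {f : E → ℝ}
    (hf : ContDiff ℝ (p : WithTop ℕ∞) f) (x s v : E) (k : ℕ) (hk : k + 1 ≤ p) :
    iteratedDeriv k (fun t : ℝ => fderiv ℝ f (x + t • s) v) =
      fun t => iteratedFDeriv ℝ (k + 1) f (x + t • s)
        (Function.update (fun _ => s) (Fin.last k) v) := by
  induction k with
  | zero =>
    funext t
    simp
  | succ k ih =>
    rw [iteratedDeriv_succ, ih (by omega)]
    funext t
    have hd : Differentiable ℝ (iteratedFDeriv ℝ (k + 1) f) :=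
      hf.differentiable_iteratedFDeriv (by exact_mod_cast hk)
    rw [(hd _).iteratedFDeriv_succ_apply_left', ← Fin.succ_last, Fin.tail_update_succ]
    have hline : HasDerivAt (fun t : ℝ => x + t • s) s t := by
      simpa using ((hasDerivAt_id t).smul_const s).const_add x
    have hg : DifferentiableAt ℝ (fun y => iteratedFDeriv ℝ (k + 1) f y
        (Function.update (fun _ => s) (Fin.last k) v)) (x + t • s) :=
      ((hd _).hasFDerivAt.continuousMultilinear_apply_const _).differentiableAt
    have := hg.hasFDerivAt.comp_hasDerivAt t hline
    rw [show Function.update (fun _ : Fin (k + 1 + 1) => s) (Fin.last k).succ v 0 = s by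
      simp [Function.update, Fin.ext_iff]]
    exact this.deriv

/-- The Taylor polynomial at `x` is differentiable, with an explicit directional derivative. -/
theorem hasFDerivAt_taylor_sum {p : ℕ} {f : E → ℝ}
    (hf : ContDiff ℝ (p : WithTop ℕ∞) f) (x s : E) :
    ∃ T' : E →L[ℝ] ℝ,
      HasFDerivAt (fun s => ∑ j ∈ Finset.range (p + 1),
        (1 / (j.factorial : ℝ)) * iteratedFDeriv ℝ j f x (fun _ => s)) T' s ∧
      ∀ v, T' v = ∑ k ∈ Finset.range p, (k.factorial : ℝ)⁻¹ *
        iteratedFDeriv ℝ (k + 1) f x (Function.update (fun _ => s) (Fin.last k) v) := by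
  have hmono (j : ℕ) : HasFDerivAt (fun s => iteratedFDeriv ℝ j f x (fun _ => s))
      (∑ i, ((iteratedFDeriv ℝ j f x).toContinuousLinearMap (fun _ => s) i) ∘L
        ContinuousLinearMap.id ℝ E) s :=
    HasFDerivAt.multilinear_comp _ fun _ => hasFDerivAt_id s
  refine ⟨_, HasFDerivAt.fun_sum fun j _ => (hmono j).const_mul _, fun v => ?_⟩
  simp only [ContinuousLinearMap.comp_id, sum_apply,
    smul_apply, smul_eq_mul]
  rw [Finset.sum_range_succ']
  simp only [Finset.univ_eq_empty, Finset.sum_empty, mul_zero, add_zero]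
  refine Finset.sum_congr rfl fun k hk => ?_
  have hk' : k + 1 ≤ p := Finset.mem_range.1 hk
  have hsym (i : Fin (k + 1)) :
      (iteratedFDeriv ℝ (k + 1) f x).toContinuousLinearMap (fun _ => s) i v =
        iteratedFDeriv ℝ (k + 1) f x (Function.update (fun _ => s) (Fin.last k) v) :=
    iteratedFDeriv_update_const_eq_last k (hf.of_le (by exact_mod_cast hk')) x s v i
  simp only [hsym, Finset.sum_const, Finset.card_univ, Fintype.card_fin, nsmul_eq_mul]
  rw [Nat.factorial_succ]
  push_cast
  field_simp

/-- If the top derivative is Lipschitz, the gradient of the Taylor polynomial approximates the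
gradient of `f`. -/
theorem norm_fderiv_sub_taylor_le {q : ℕ} {f : E → ℝ} {L : ℝ} (hL : 0 ≤ L)
    (hf : ContDiff ℝ ((q + 2 : ℕ) : WithTop ℕ∞) f)
    (hLip : ∀ x y : E, ‖iteratedFDeriv ℝ (q + 2) f x - iteratedFDeriv ℝ (q + 2) f y‖ ≤
      ((q + 1).factorial : ℝ) * L * ‖x - y‖) (x s v : E) :
    |fderiv ℝ f (x + s) v - ∑ k ∈ Finset.range (q + 2), (k.factorial : ℝ)⁻¹ *
        iteratedFDeriv ℝ (k + 1) f x (Function.update (fun _ => s) (Fin.last k) v)| ≤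
      L * ‖s‖ ^ (q + 2) * ‖v‖ := by
  set φ : ℝ → ℝ := fun t => fderiv ℝ f (x + t • s) v with hφ
  have hiter := iteratedDeriv_fderiv_comp_line hf x s v
  have hφc : ContDiff ℝ ((q + 1 : ℕ) : WithTop ℕ∞) φ := by
    have h1 : ContDiff ℝ ((q + 1 : ℕ) : WithTop ℕ∞) (fderiv ℝ f) :=
      hf.fderiv_right (by norm_cast)
    exact (h1.comp (by fun_prop : ContDiff ℝ _ fun t : ℝ => x + t • s)).clm_apply contDiff_const
  obtain ⟨ξ, hξ, h⟩ := taylor_mean_remainder_lagrange_iteratedDeriv (f := φ) (n := q)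
    (zero_ne_one (α := ℝ)) (by exact_mod_cast hφc.contDiffOn)
  have hξ' : 0 < ξ ∧ ξ < 1 := by simpa [Set.uIoo] using hξ
  have htaylor : taylorWithinEval φ q (Set.uIcc 0 1) 0 1 =
      ∑ k ∈ Finset.range (q + 1), (k.factorial : ℝ)⁻¹ *
        iteratedFDeriv ℝ (k + 1) f x (Function.update (fun _ => s) (Fin.last k) v) := by
    rw [taylor_within_apply]
    refine Finset.sum_congr rfl fun k hk => ?_
    have hk' := Finset.mem_range.1 hk
    rw [iteratedDerivWithin_eq_iteratedDeriv (uniqueDiffOn_uIcc zero_ne_one)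
      (hφc.contDiffAt.of_le (by exact_mod_cast hk'.le)) (by simp), hiter k (by omega)]
    simp
  rw [htaylor, hiter (q + 1) le_rfl] at h
  rw [Finset.sum_range_succ]
  set u : Fin (q + 1 + 1) → E := Function.update (fun _ => s) (Fin.last (q + 1)) v with hu
  have hprod : ∏ i, ‖u i‖ = ‖s‖ ^ (q + 1) * ‖v‖ := by
    rw [Fin.prod_univ_castSucc]
    simp [hu, Fin.ext_iff, Fin.val_last, (Fin.is_lt _).ne]
  have hbound : |iteratedFDeriv ℝ (q + 1 + 1) f (x + ξ • s) u -
      iteratedFDeriv ℝ (q + 1 + 1) f x u| ≤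
      ((q + 1).factorial : ℝ) * L * ‖s‖ * (‖s‖ ^ (q + 1) * ‖v‖) := by
    rw [← sub_apply, ← Real.norm_eq_abs, ← hprod]
    refine (ContinuousMultilinearMap.le_opNorm _ _).trans ?_
    gcongr
    refine (hLip _ _).trans ?_
    gcongr
    rw [add_sub_cancel_left, norm_smul, Real.norm_of_nonneg hξ'.1.le]
    exact mul_le_of_le_one_left (norm_nonneg _) hξ'.2.le
  have hfac : (0 : ℝ) < (q + 1).factorial := by positivity
  have heq : fderiv ℝ f (x + s) v - (∑ k ∈ Finset.range (q + 1), (k.factorial : ℝ)⁻¹ *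
        iteratedFDeriv ℝ (k + 1) f x (Function.update (fun _ => s) (Fin.last k) v) +
        ((q + 1).factorial : ℝ)⁻¹ * iteratedFDeriv ℝ (q + 1 + 1) f x u) =
      (iteratedFDeriv ℝ (q + 1 + 1) f (x + ξ • s) u -
      iteratedFDeriv ℝ (q + 1 + 1) f x u) / (q + 1).factorial := by
    have h1 : φ 1 = fderiv ℝ f (x + s) v := by simp [hφ]
    rw [h1] at h
    rw [← sub_sub, h]
    simp
    ring
  rw [heq, abs_div, abs_of_pos hfac, div_le_iff₀ hfac]
  refine hbound.trans (le_of_eq ?_)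
  ring

end Taylor

theorem norm_gradient {F : Type*} [NormedAddCommGroup F] [InnerProductSpace ℝ F] [CompleteSpace F]
    (f : F → ℝ) (x : F) : ‖gradient f x‖ = ‖fderiv ℝ f x‖ := by
  simp [gradient]

theorem stmt13 {n : ℕ} (p : ℕ) (hp : 2 ≤ p) (f : EuclideanSpace ℝ (Fin n) → ℝ)
    (L θ σk σmin σmax flow η₁ ε₁ : ℝ) (hL : 0 ≤ L) (hθ : 0 ≤ θ)
    (hσmin : 0 < σmin) (hσ₁ : σmin ≤ σk) (hσ₂ : σk ≤ σmax)
    (hη₁ : 0 < η₁) (hη₁' : η₁ < 1) (hε₁ : 0 < ε₁)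
    (hf : ContDiff ℝ (p : ℕ∞) f) (hflow : ∀ z, flow ≤ f z)
    (hLip : ∀ x y : EuclideanSpace ℝ (Fin n),
      ‖iteratedFDeriv ℝ p f x - iteratedFDeriv ℝ p f y‖ ≤ ((p - 1).factorial : ℝ) * L * ‖x - y‖)
    (x s : EuclideanSpace ℝ (Fin n))
    (hdec : taylorP p f x 0 - taylorP p f x s ≥ σk / ((p : ℝ) + 1) * ‖s‖ ^ (p + 1))
    (hgrad : ‖gradient (fun s' => modelM p f x s' σk) s‖ ≤ θ * ‖s‖ ^ p)
    (hacc : f x - f (x + s) ≥ η₁ * (taylorP p f x 0 - taylorP p f x s))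
    (hcrit : ‖gradient f (x + s)‖ > ε₁) :
    f x - f (x + s) ≥
      η₁ * σmin / ((p : ℝ) + 1) * (ε₁ / (L + θ + σmax)) ^ (((p : ℝ) + 1) / p) := by
  obtain ⟨q, rfl⟩ : ∃ q, p = q + 2 := ⟨p - 2, by omega⟩
  have hf' : ContDiff ℝ ((q + 2 : ℕ) : WithTop ℕ∞) f := by exact_mod_cast hf
  obtain ⟨T', hT', hT'v⟩ := hasFDerivAt_taylor_sum hf' x s
  have hrem : ‖fderiv ℝ f (x + s) - T'‖ ≤ L * ‖s‖ ^ (q + 2) := by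
    refine ContinuousLinearMap.opNorm_le_bound _ (by positivity) fun v => ?_
    rw [sub_apply, hT'v, Real.norm_eq_abs]
    exact norm_fderiv_sub_taylor_le hL hf' hLip x s v
  have hσk : 0 < σk := hσmin.trans_le hσ₁
  have hp1 : (1 : ℝ) < ((q + 2 + 1 : ℕ) : ℝ) := by push_cast; linarith [q.cast_nonneg (α := ℝ)]
  set R' := fderiv ℝ (fun y : EuclideanSpace ℝ (Fin n) => ‖y‖ ^ (((q + 2 + 1 : ℕ) : ℝ))) s with hR'
  have hR'n : ‖R'‖ = ((q + 2 + 1 : ℕ) : ℝ) * ‖s‖ ^ (q + 2) := by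
    rw [hR', norm_fderiv_norm_id_rpow s hp1, ← Real.rpow_natCast]
    push_cast
    ring_nf
  have hR : HasFDerivAt (fun y : EuclideanSpace ℝ (Fin n) => ‖y‖ ^ (q + 2 + 1)) R' s := by
    simpa only [hR', Real.rpow_natCast] using (differentiable_norm_rpow hp1 s).hasFDerivAt
  have hm : HasFDerivAt (fun s' => modelM (q + 2) f x s' σk)
      (T' + (σk / (((q + 2 : ℕ) : ℝ) + 1)) • R') s := hT'.add (hR.const_mul _)
  rw [norm_gradient, hm.fderiv] at hgrad
  rw [norm_gradient] at hcrit
  have hreg : ‖(σk / (((q + 2 : ℕ) : ℝ) + 1)) • R'‖ = σk * ‖s‖ ^ (q + 2) := by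
    rw [norm_smul, hR'n, Real.norm_of_nonneg (by positivity)]
    push_cast
    field_simp
  have hstep : ε₁ < (L + θ + σmax) * ‖s‖ ^ (q + 2) := by
    have h1 : ‖fderiv ℝ f (x + s)‖ ≤ ‖fderiv ℝ f (x + s) - T'‖ +
        ‖T' + (σk / (((q + 2 : ℕ) : ℝ) + 1)) • R'‖ +
        ‖(σk / (((q + 2 : ℕ) : ℝ) + 1)) • R'‖ := by
      refine le_trans (le_of_eq ?_) ((norm_sub_le _ _).trans
        (add_le_add_left (norm_add_le _ _) _))
      congr 1
      abel
    have h2 : σk * ‖s‖ ^ (q + 2) ≤ σmax * ‖s‖ ^ (q + 2) := by gcongr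
    linarith
  have hden : 0 < L + θ + σmax := by linarith
  have hpow : (ε₁ / (L + θ + σmax)) ^ ((((q + 2 : ℕ) : ℝ) + 1) / ((q + 2 : ℕ) : ℝ)) ≤
      ‖s‖ ^ (q + 2 + 1) := by
    have h1 : ε₁ / (L + θ + σmax) ≤ ‖s‖ ^ (q + 2) := by
      rw [div_le_iff₀' hden]
      exact hstep.le
    refine (Real.rpow_le_rpow (by positivity) h1 (by positivity)).trans (le_of_eq ?_)
    rw [← Real.rpow_natCast, ← Real.rpow_mul (norm_nonneg _), ← Real.rpow_natCast]
    congr 1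
    push_cast
    field_simp
  calc η₁ * σmin / (((q + 2 : ℕ) : ℝ) + 1) * (ε₁ / (L + θ + σmax)) ^
        ((((q + 2 : ℕ) : ℝ) + 1) / ((q + 2 : ℕ) : ℝ))
      ≤ η₁ * σk / (((q + 2 : ℕ) : ℝ) + 1) * ‖s‖ ^ (q + 2 + 1) := by gcongr
    _ = η₁ * (σk / (((q + 2 : ℕ) : ℝ) + 1) * ‖s‖ ^ (q + 2 + 1)) := by ring
    _ ≤ η₁ * (taylorP (q + 2) f x 0 - taylorP (q + 2) f x s) := by gcongr
    _ ≤ f x - f (x + s) := hacc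
end
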